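/- Let G ∈ S_n^{r,t} be a connected bicyclic graph of order n = 7 whose two cycles have lengths r and t and share exactly one common vertex. Then ABC_GG(G) ≤ sqrt(3) + 2·sqrt(2) + 2·sqrt(5/6), with equality if and only if G = S_7^{3,3}(1, 1, 0). -/

import Mathlib

/-- `sideCount G u v` is the number of vertices of `G` whose distance to `u`
is strictly smaller than their distance to `v`. -/
noncomputable def sideCount {V : Type*} [Fintype V] (G : SimpleGraph V) (u v : V) : ℕ :=
  Nat.card {w : V // G.dist w u < G.dist w v}

open Classical in
/-- The Graovac–Ghorbani index
`ABC_GG(G) = Σ_{uv ∈ E(G)} sqrt ((n_u + n_v - 2) / (n_u * n_v))`,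
computed as half the sum over ordered adjacent pairs. -/
noncomputable def ABCGG {V : Type*} [Fintype V] (G : SimpleGraph V) : ℝ :=
  (1 / 2) * ∑ u : V, ∑ v : V,
    if G.Adj u v then
      Real.sqrt (((sideCount G u v : ℝ) + (sideCount G v u : ℝ) - 2) /
        ((sideCount G u v : ℝ) * (sideCount G v u : ℝ)))
    else 0

/-- `G ∈ S_n^{r,t}`: `G` is a bicyclic graph of order `n` possessing two cycles, of
lengths `r` and `t`, sharing exactly one common vertex. -/
def InSnrt {V : Type*} [Fintype V] (G : SimpleGraph V) (n r t : ℕ) : Prop :=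
  Fintype.card V = n ∧ G.Connected ∧ G.edgeSet.ncard = n + 1 ∧
  ∃ (a b : V) (c1 : G.Walk a a) (c2 : G.Walk b b),
    c1.IsCycle ∧ c2.IsCycle ∧ c1.length = r ∧ c2.length = t ∧
    ({v | v ∈ c1.support} ∩ {v | v ∈ c2.support}).ncard = 1

/-- Vertex type for `S_n^{3,3}(m1,m2,n1,n2,m0)`: the five cycle vertices
(`0` = common vertex `u`, `1,2` = the other vertices of the first triangle,
`3,4` = the other vertices of the second triangle) together with the pendent
vertices. -/
abbrev SVert (m1 m2 n1 n2 m0 : ℕ) : Type :=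
  Fin 5 ⊕ Fin m1 ⊕ Fin m2 ⊕ Fin n1 ⊕ Fin n2 ⊕ Fin m0

/-- The graph `S_n^{3,3}(m1,m2,n1,n2,m0)`: two triangles sharing exactly the vertex `u`,
with `m1, m2` pendent vertices attached to the two non-common vertices of the first
triangle, `n1, n2` pendent vertices attached to those of the second triangle, and
`m0` pendent vertices attached to `u`.  `S_n^{3,3}(m1,n1,m0)` is `S33 m1 0 n1 0 m0`. -/
def S33 (m1 m2 n1 n2 m0 : ℕ) : SimpleGraph (SVert m1 m2 n1 n2 m0) :=
  SimpleGraph.fromRel (fun x y =>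
    (x = Sum.inl 0 ∧ y = Sum.inl 1) ∨
    (x = Sum.inl 1 ∧ y = Sum.inl 2) ∨
    (x = Sum.inl 2 ∧ y = Sum.inl 0) ∨
    (x = Sum.inl 0 ∧ y = Sum.inl 3) ∨
    (x = Sum.inl 3 ∧ y = Sum.inl 4) ∨
    (x = Sum.inl 4 ∧ y = Sum.inl 0) ∨
    (∃ i : Fin m1, x = Sum.inl 1 ∧ y = Sum.inr (Sum.inl i)) ∨
    (∃ i : Fin m2, x = Sum.inl 2 ∧ y = Sum.inr (Sum.inr (Sum.inl i))) ∨
    (∃ i : Fin n1, x = Sum.inl 3 ∧ y = Sum.inr (Sum.inr (Sum.inr (Sum.inl i)))) ∨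
    (∃ i : Fin n2, x = Sum.inl 4 ∧ y = Sum.inr (Sum.inr (Sum.inr (Sum.inr (Sum.inl i))))) ∨
    (∃ i : Fin m0, x = Sum.inl 0 ∧ y = Sum.inr (Sum.inr (Sum.inr (Sum.inr (Sum.inr i))))))


/-- `closedBall G u k` is the set of vertices reachable from `u` in at most `k` steps. -/
def closedBall {V : Type*} [Fintype V] [DecidableEq V] (G : SimpleGraph V) [DecidableRel G.Adj]
    (u : V) : ℕ → Finset V
  | 0 => {u}
  | k + 1 => Finset.univ.filter fun v =>
      v ∈ closedBall G u k ∨ ∃ w ∈ closedBall G u k, G.Adj w v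

/-- A computable form of `sideCount` for connected graphs. -/
def sideCountFin {V : Type*} [Fintype V] [DecidableEq V] (G : SimpleGraph V) [DecidableRel G.Adj]
    (u v : V) : ℕ :=
  (Finset.univ.filter fun w => ∃ k ∈ Finset.range (Fintype.card V),
      w ∈ closedBall G u k ∧ w ∉ closedBall G v k).card

/-- An upper bound, in hundredths, for the contribution of an edge to `ABCGG`. -/
def sqrtBound (a b : ℕ) : ℕ := Nat.sqrt (10000 * (a + b - 2) / (a * b)) + 1

/-- An upper bound, in units of `1 / 200`, for `ABCGG`. -/
def abcBound {V : Type*} [Fintype V] [DecidableEq V] (G : SimpleGraph V) [DecidableRel G.Adj] :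
    ℕ :=
  ∑ u : V, ∑ v : V,
    if G.Adj u v then sqrtBound (sideCountFin G u v) (sideCountFin G v u) else 0

/-- The graph on `Fin 7` with the listed edges. -/
def listGraph (E : List (ℕ × ℕ)) : SimpleGraph (Fin 7) :=
  SimpleGraph.fromRel fun i j => ((i : ℕ), (j : ℕ)) ∈ E

instance (E : List (ℕ × ℕ)) : DecidableRel (listGraph E).Adj :=
  fun i j =>
    decidable_of_iff' _ (SimpleGraph.fromRel_adj (fun i j : Fin 7 => ((i : ℕ), (j : ℕ)) ∈ E) i j)

instance (m1 m2 n1 n2 m0 : ℕ) : DecidableRel (S33 m1 m2 n1 n2 m0).Adj :=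
  fun x y =>
    haveI : DecidableEq (SVert m1 m2 n1 n2 m0) := inferInstance
    decidable_of_iff' _ (SimpleGraph.fromRel_adj _ x y)

section Computation

variable {V : Type*} [Fintype V]

theorem mem_closedBall [DecidableEq V] (G : SimpleGraph V) [DecidableRel G.Adj] (u v : V) (k : ℕ) :
    v ∈ closedBall G u k ↔ ∃ p : G.Walk u v, p.length ≤ k := by
  induction k generalizing v with
  | zero =>
    simp only [closedBall, Finset.mem_singleton, Nat.le_zero]
    constructor
    · rintro rfl
      exact ⟨.nil, rfl⟩
    · rintro ⟨p, hp⟩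
      exact (SimpleGraph.Walk.eq_of_length_eq_zero hp).symm
  | succ k ih =>
    simp only [closedBall, Finset.mem_filter, Finset.mem_univ, true_and, ih]
    constructor
    · rintro (⟨p, hp⟩ | ⟨w, ⟨p, hp⟩, h⟩)
      · exact ⟨p, by omega⟩
      · exact ⟨p.concat h, by simpa using hp⟩
    · rintro ⟨p, hp⟩
      cases p using SimpleGraph.Walk.concatRec with
      | Hnil => exact .inl ⟨.nil, by simp⟩
      | Hconcat p h =>
        exact .inr ⟨_, ⟨p, by simpa using hp⟩, h⟩

theorem mem_closedBall_iff_dist_le [DecidableEq V] {G : SimpleGraph V} [DecidableRel G.Adj]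
    (hG : G.Connected) (u v : V) (k : ℕ) : v ∈ closedBall G u k ↔ G.dist u v ≤ k := by
  rw [mem_closedBall]
  constructor
  · rintro ⟨p, hp⟩
    exact (G.dist_le p).trans hp
  · intro h
    obtain ⟨p, hp⟩ := hG.exists_walk_length_eq_dist u v
    exact ⟨p, by omega⟩

theorem sideCount_eq_sideCountFin [DecidableEq V] {G : SimpleGraph V} [DecidableRel G.Adj]
    (hG : G.Connected) (u v : V) : sideCount G u v = sideCountFin G u v := by
  classical
  rw [sideCount, sideCountFin, Nat.card_eq_fintype_card, Fintype.card_subtype]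
  congr 1
  ext w
  simp only [Finset.mem_filter, Finset.mem_univ, true_and, Finset.mem_range,
    mem_closedBall_iff_dist_le hG, G.dist_comm (u := u), G.dist_comm (u := v)]
  constructor
  · intro h
    obtain ⟨p, hp, hlen⟩ := hG.exists_path_of_dist w u
    exact ⟨G.dist w u, hlen ▸ hp.length_lt, le_rfl, by omega⟩
  · rintro ⟨k, -, h₁, h₂⟩
    omega

theorem sqrt_le_sqrtBound (a b : ℕ) :
    √(((a : ℝ) + b - 2) / (a * b)) ≤ (sqrtBound a b : ℝ) / 100 := by
  refine Real.sqrt_le_iff.mpr ⟨by positivity, ?_⟩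
  rcases Nat.eq_zero_or_pos (a * b) with h | h
  · rw [← Nat.cast_mul, h]
    simp only [Nat.cast_zero, div_zero]
    positivity
  have ha : 0 < a := Nat.pos_of_mul_pos_right h
  have hb : 0 < b := Nat.pos_of_mul_pos_left h
  have h₁ : 10000 * (a + b - 2) < sqrtBound a b ^ 2 * (a * b) := by
    rw [← Nat.div_lt_iff_lt_mul h, sq]
    exact Nat.lt_succ_sqrt _
  have h₂ : ((a + b - 2 : ℕ) : ℝ) = (a : ℝ) + b - 2 := by
    rw [Nat.cast_sub (by omega)]
    push_cast
    ring
  have h₃ : 10000 * ((a : ℝ) + b - 2) < (sqrtBound a b : ℝ) ^ 2 * (a * b) := by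
    rw [← h₂]
    exact_mod_cast h₁
  have h₄ : (0 : ℝ) < a * b := by exact_mod_cast h
  rw [div_le_iff₀ h₄]
  nlinarith

theorem ABCGG_le_abcBound [DecidableEq V] {G : SimpleGraph V} [DecidableRel G.Adj]
    (hG : G.Connected) : ABCGG G ≤ (abcBound G : ℝ) / 200 := by
  have h : (abcBound G : ℝ) / 200 = 1 / 2 * ((abcBound G : ℝ) / 100) := by ring
  rw [h, ABCGG, abcBound, Nat.cast_sum, Finset.sum_div]
  gcongr with u
  rw [Nat.cast_sum, Finset.sum_div]
  gcongr with v
  rw [sideCount_eq_sideCountFin hG, sideCount_eq_sideCountFin hG]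
  split_ifs
  · exact sqrt_le_sqrtBound _ _
  · simp

theorem ABCGG_eq_sum_map [DecidableEq V] {G : SimpleGraph V} [DecidableRel G.Adj]
    (hG : G.Connected) :
    ABCGG G = 1 / 2 * (((Finset.univ.filter fun p : V × V => G.Adj p.1 p.2).val.map
      fun p => (sideCountFin G p.1 p.2, sideCountFin G p.2 p.1)).map
        fun q => √(((q.1 : ℝ) + q.2 - 2) / (q.1 * q.2))).sum := by
  rw [Multiset.map_map, ABCGG, ← Fintype.sum_prod_type']
  congr 1
  simp only [sideCount_eq_sideCountFin hG]
  rw [← Finset.sum_filter]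
  simp only [Finset.sum, Function.comp_def]

end Computation

theorem dist_iso {V W : Type*} {G : SimpleGraph V} {H : SimpleGraph W} (e : G ≃g H) (u v : V) :
    H.dist (e u) (e v) = G.dist u v := by
  by_cases h : G.Reachable u v
  · apply le_antisymm
    · obtain ⟨p, hp⟩ := h.exists_walk_length_eq_dist
      rw [← hp, ← p.length_map e.toHom]
      exact H.dist_le _
    obtain ⟨p, hp⟩ := (e.reachable_iff.mpr h).exists_walk_length_eq_dist
    have := G.dist_le ((p.map e.symm.toHom).copy (e.symm_apply_apply u) (e.symm_apply_apply v))
    simpa [hp] using this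
  · rw [SimpleGraph.dist_eq_zero_of_not_reachable h,
      SimpleGraph.dist_eq_zero_of_not_reachable (mt e.reachable_iff.mp h)]

theorem sideCount_iso {V W : Type*} [Fintype V] [Fintype W] {G : SimpleGraph V}
    {H : SimpleGraph W} (e : G ≃g H) (u v : V) : sideCount H (e u) (e v) = sideCount G u v := by
  refine (Nat.card_congr (e.toEquiv.subtypeEquiv fun w => ?_)).symm
  simp only [RelIso.coe_fn_toEquiv, dist_iso]

theorem ABCGG_iso {V W : Type*} [Fintype V] [Fintype W] {G : SimpleGraph V}
    {H : SimpleGraph W} (e : G ≃g H) : ABCGG G = ABCGG H := by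
  unfold ABCGG
  congr 1
  refine Fintype.sum_equiv e.toEquiv _ _ fun u => Fintype.sum_equiv e.toEquiv _ _ fun v => ?_
  simp only [RelIso.coe_fn_toEquiv, sideCount_iso]
  congr 1
  exact propext e.map_adj_iff.symm

theorem nonempty_iso_of_ncard_edgeSet_le {V W : Type*} [Fintype V] [Fintype W]
    {H : SimpleGraph V} {G : SimpleGraph W} (f : V → W) (hf : f.Injective)
    (hcard : Fintype.card V = Fintype.card W) (hadj : ∀ u v, H.Adj u v → G.Adj (f u) (f v))
    (hedge : G.edgeSet.ncard ≤ H.edgeSet.ncard) : Nonempty (H ≃g G) := by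
  have hbij := (Fintype.bijective_iff_injective_and_card f).mpr ⟨hf, hcard⟩
  let f' : V ↪ W := ⟨f, hf⟩
  have hle : H.map f' ≤ G := by
    rintro a b ⟨-, u, v, huv, rfl, rfl⟩
    exact hadj u v huv
  have heq : H.map f' = G := by
    refine SimpleGraph.edgeSet_injective
      (Set.eq_of_subset_of_ncard_le (SimpleGraph.edgeSet_mono hle) ?_ (Set.toFinite _))
    rwa [SimpleGraph.edgeSet_map, Set.ncard_image_of_injective _ f'.sym2Map.injective]
  exact ⟨heq ▸ SimpleGraph.Iso.map (Equiv.ofBijective f hbij) H⟩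

theorem ABCGG_S33 (h : (S33 1 0 1 0 0).Connected) :
    ABCGG (S33 1 0 1 0 0) = √3 + 2 * √2 + 2 * √(5 / 6) := by
  have hval : ((Finset.univ.filter fun p : SVert 1 0 1 0 0 × SVert 1 0 1 0 0 =>
      (S33 1 0 1 0 0).Adj p.1 p.2).val.map fun p =>
        (sideCountFin (S33 1 0 1 0 0) p.1 p.2, sideCountFin (S33 1 0 1 0 0) p.2 p.1)) =
      {(4, 2), (4, 2), (2, 4), (2, 4), (2, 1), (2, 1), (1, 2), (1, 2),
        (1, 4), (1, 4), (4, 1), (4, 1), (6, 1), (6, 1), (1, 6), (1, 6)} := by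
    decide +kernel
  have h₂ : √(1 / 2 : ℝ) = √2 / 2 := by
    rw [Real.sqrt_eq_iff_mul_self_eq (by positivity) (by positivity)]
    nlinarith [Real.sq_sqrt (show (0 : ℝ) ≤ 2 by norm_num)]
  have h₃ : √(3 / 4 : ℝ) = √3 / 2 := by
    rw [Real.sqrt_eq_iff_mul_self_eq (by positivity) (by positivity)]
    nlinarith [Real.sq_sqrt (show (0 : ℝ) ≤ 3 by norm_num)]
  rw [ABCGG_eq_sum_map h, hval]
  simp only [Multiset.insert_eq_cons, Multiset.map_cons, Multiset.map_singleton,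
    Multiset.sum_cons, Multiset.sum_singleton]
  norm_num only [h₂, h₃]
  ring

theorem lt_extremal_value : (1270 : ℝ) / 200 < √3 + 2 * √2 + 2 * √(5 / 6) := by
  have h₁ : (1.73 : ℝ) < √3 := Real.lt_sqrt_of_sq_lt (by norm_num)
  have h₂ : (1.41 : ℝ) < √2 := Real.lt_sqrt_of_sq_lt (by norm_num)
  have h₃ : (0.91 : ℝ) < √(5 / 6) := Real.lt_sqrt_of_sq_lt (by norm_num)
  linarith

/-- The vertices listed in `L`, without repetition, span edges at all the positions in `E`. -/
structure Realizes {V : Type*} (G : SimpleGraph V) (L : List V) (E : List (ℕ × ℕ)) : Prop where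
  nodup : L.Nodup
  adj : ∀ e ∈ E, ∃ a b, L[e.1]? = some a ∧ L[e.2]? = some b ∧ G.Adj a b

theorem Realizes.exists_extend {V : Type*} [Fintype V] {G : SimpleGraph V} {L : List V}
    {E : List (ℕ × ℕ)} (h : Realizes G L E) (hG : G.Connected) (hpos : 0 < L.length)
    (hlt : L.length < Fintype.card V) :
    ∃ i < L.length, ∃ v, Realizes G (L ++ [v]) ((i, L.length) :: E) := by
  classical
  obtain ⟨y, hy⟩ : ∃ y, y ∉ L := by
    by_contra! hall
    have : (Finset.univ : Finset V) ⊆ L.toFinset := fun v _ => by simpa using hall v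
    have := Finset.card_le_card this
    have := L.toFinset_card_le
    rw [Finset.card_univ] at *
    omega
  obtain ⟨p⟩ := hG.preconnected L[0] y
  obtain ⟨d, -, hd₁, hd₂⟩ := p.exists_boundary_dart {v | v ∈ L} (List.getElem_mem _) hy
  obtain ⟨i, hi, hid⟩ := List.getElem_of_mem hd₁
  refine ⟨i, hi, d.snd, ?_, ?_⟩
  · rw [List.nodup_append]
    refine ⟨h.nodup, by simp, ?_⟩
    rintro a ha b hb rfl
    rw [List.mem_singleton.mp hb] at ha
    exact hd₂ ha
  · intro e he
    rcases List.mem_cons.mp he with rfl | he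
    · refine ⟨d.fst, d.snd, ?_, by simp, d.adj⟩
      rw [List.getElem?_append_left hi, List.getElem?_eq_getElem hi, hid]
    · obtain ⟨a, b, ha, hb, hab⟩ := h.adj e he
      refine ⟨a, b, ?_, ?_, hab⟩
      · rw [List.getElem?_append_left (List.getElem?_eq_some_iff.mp ha).1, ha]
      · rw [List.getElem?_append_left (List.getElem?_eq_some_iff.mp hb).1, hb]

theorem Realizes.nonempty_iso {V : Type*} [Fintype V] {G : SimpleGraph V} {L : List V}
    {E : List (ℕ × ℕ)} (h : Realizes G L E) (hV : Fintype.card V = 7) (hL : L.length = 7)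
    (hedge : G.edgeSet.ncard ≤ (listGraph E).edgeFinset.card) : Nonempty (listGraph E ≃g G) := by
  refine nonempty_iso_of_ncard_edgeSet_le (fun i : Fin 7 => L[i]) ?_ (by simp [hV]) ?_ ?_
  · intro i j hij
    exact Fin.ext ((h.nodup.getElem_inj_iff).mp hij)
  · have key (i j : Fin 7) (hij : ((i : ℕ), (j : ℕ)) ∈ E) : G.Adj L[i] L[j] := by
      obtain ⟨a, b, ha, hb, hab⟩ := h.adj _ hij
      obtain ⟨_, rfl⟩ := List.getElem?_eq_some_iff.mp ha
      obtain ⟨_, rfl⟩ := List.getElem?_eq_some_iff.mp hb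
      exact hab
    intro i j hij
    rcases ((SimpleGraph.fromRel_adj _ _ _).mp hij).2 with hij | hij
    · exact key i j hij
    · exact (key j i hij).symm
  · rwa [← (listGraph E).coe_edgeFinset, Set.ncard_coe_finset]

theorem Realizes.ABCGG_lt {V : Type*} [Fintype V] {G : SimpleGraph V} {L : List V}
    {E : List (ℕ × ℕ)} (h : Realizes G L E) (hG : G.Connected) (hV : Fintype.card V = 7)
    (hL : L.length = 7) (hedge : G.edgeSet.ncard = 8)
    (hE : (listGraph E).edgeFinset.card = 8) (hbound : abcBound (listGraph E) < 1270) :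
    ABCGG G < √3 + 2 * √2 + 2 * √(5 / 6) := by
  obtain ⟨e⟩ := h.nonempty_iso hV hL (by rw [hedge, hE])
  rw [← ABCGG_iso e]
  refine (ABCGG_le_abcBound (e.connected_iff.mpr hG)).trans_lt (lt_of_le_of_lt ?_ lt_extremal_value)
  gcongr
  exact_mod_cast hbound.le

/-- Two cycles of lengths `m + 1` and `k + 1` through the position `0`. -/
def twoCycles (m k : ℕ) : List (ℕ × ℕ) :=
  (List.range m).map (fun i => (i, i + 1)) ++ [(m, 0), (0, m + 1)] ++
    (List.range (k - 1)).map (fun i => (m + 1 + i, m + 2 + i)) ++ [(m + k, 0)]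

/-- A labelling of two triangles with pendent positions `5` and `6` attached at `i` and `j`,
which is an isomorphism onto the extremal graph when `i` and `j` lie in different triangles
and are not the common vertex. -/
def extremalLabel (i j : ℕ) (k : Fin 7) : SVert 1 0 1 0 0 :=
  if k.val = 0 then .inl 0 else if k.val = i then .inl 1 else if k.val = j then .inl 3
  else if k.val = 5 then .inr (.inl 0) else if k.val = 6 then .inr (.inr (.inr (.inl 0)))
  else if (k.val ≤ 2 ↔ i ≤ 2) then .inl 2 else .inl 4

set_option synthInstance.maxSize 1000 in
theorem two_triangles_cases : ∀ i < 5, ∀ j < 6,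
    (listGraph ((j, 6) :: (i, 5) :: twoCycles 2 2)).edgeFinset.card = 8 ∧
    (abcBound (listGraph ((j, 6) :: (i, 5) :: twoCycles 2 2)) < 1270 ∨
      (extremalLabel i j).Injective ∧
      ∀ u v, (listGraph ((j, 6) :: (i, 5) :: twoCycles 2 2)).Adj u v →
        (S33 1 0 1 0 0).Adj (extremalLabel i j u) (extremalLabel i j v)) := by
  decide +kernel

theorem ncard_edgeSet_S33 : (S33 1 0 1 0 0).edgeSet.ncard = 8 := by
  rw [← SimpleGraph.coe_edgeFinset, Set.ncard_coe_finset]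
  decide +kernel

theorem triangle_square_cases : ∀ i < 6,
    (listGraph ((i, 6) :: twoCycles 2 3)).edgeFinset.card = 8 ∧
    abcBound (listGraph ((i, 6) :: twoCycles 2 3)) < 1270 := by
  decide +kernel

/-- A cycle through `x`, listed from `x`. -/
theorem exists_list_of_isCycle {V : Type*} {G : SimpleGraph V} {a x : V} {c : G.Walk a a}
    (hc : c.IsCycle) (hx : x ∈ c.support) :
    ∃ l : List V, 2 ≤ l.length ∧ (x :: l).Nodup ∧ (x :: l ++ [x]).IsChain G.Adj ∧
      ∀ y ∈ l, y ∈ c.support := by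
  classical
  have hc' : (c.rotate x hx).IsCycle := hc.rotate hx
  have hsub : ∀ y ∈ (c.rotate x hx).support, y ∈ c.support :=
    fun y hy => (c.mem_support_rotate_iff x hx).mp hy
  generalize c.rotate x hx = d at hc' hsub
  have hlen := hc'.three_le_length
  cases d with
  | nil => simp at hlen
  | cons h p =>
    have hp : p.support = p.support.dropLast ++ [x] := by
      conv_lhs => rw [← List.dropLast_append_getLast p.support_ne_nil, p.getLast_support]
    have hnd := hc'.support_nodup
    have hch := (SimpleGraph.Walk.cons h p).isChain_adj_support
    have hsl := p.length_support
    rw [SimpleGraph.Walk.support_cons, hp] at hsub hch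
    rw [SimpleGraph.Walk.support_cons, List.tail_cons, hp] at hnd
    refine ⟨p.support.dropLast, ?_, ?_, by simpa using hch, fun y hy =>
      hsub y (List.mem_cons_of_mem _ (List.mem_append_left _ hy))⟩
    · simp only [SimpleGraph.Walk.length_cons] at hlen
      simp only [List.length_dropLast]
      omega
    · exact (List.perm_append_singleton x _).nodup_iff.mp hnd

theorem realizes_twoCycles {V : Type*} {G : SimpleGraph V} {x : V} {l₁ l₂ : List V}
    (h₁ : 2 ≤ l₁.length) (h₁₂ : l₁.length ≤ l₂.length) (hle : (x :: l₁ ++ l₂).length ≤ 7)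
    (hnd : (x :: l₁ ++ l₂).Nodup) (hc₁ : (x :: l₁ ++ [x]).IsChain G.Adj)
    (hc₂ : (x :: l₂ ++ [x]).IsChain G.Adj) :
    Realizes G (x :: l₁ ++ l₂) (twoCycles l₁.length l₂.length) := by
  refine ⟨hnd, ?_⟩
  clear hnd
  simp only [List.cons_append, List.length_cons, List.length_append] at hle
  obtain ⟨hm, hk⟩ | ⟨hm, hk⟩ | ⟨hm, hk⟩ | ⟨hm, hk⟩ :
      l₁.length = 2 ∧ l₂.length = 2 ∨ l₁.length = 2 ∧ l₂.length = 3 ∨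
      l₁.length = 2 ∧ l₂.length = 4 ∨ l₁.length = 3 ∧ l₂.length = 3 := by omega
  all_goals
    simp only [List.length_eq_two, List.length_eq_three, List.length_eq_four] at hm hk
  · obtain ⟨a, b, rfl⟩ := hm
    obtain ⟨c, d, rfl⟩ := hk
    simp_all [twoCycles, List.range_succ]
  · obtain ⟨a, b, rfl⟩ := hm
    obtain ⟨c, d, e, rfl⟩ := hk
    simp_all [twoCycles, List.range_succ]
  · obtain ⟨a, b, rfl⟩ := hm
    obtain ⟨c, d, e, f, rfl⟩ := hk
    simp_all [twoCycles, List.range_succ]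
  · obtain ⟨a, b, c, rfl⟩ := hm
    obtain ⟨d, e, f, rfl⟩ := hk
    simp_all [twoCycles, List.range_succ]

theorem ABCGG_lt_or_nonempty_iso {V : Type*} [Fintype V] {G : SimpleGraph V}
    (hV : Fintype.card V = 7) (hG : G.Connected) (hedge : G.edgeSet.ncard = 8) {x : V}
    {l₁ l₂ : List V} (h₁ : 2 ≤ l₁.length) (h₁₂ : l₁.length ≤ l₂.length)
    (hnd : (x :: l₁ ++ l₂).Nodup) (hc₁ : (x :: l₁ ++ [x]).IsChain G.Adj)
    (hc₂ : (x :: l₂ ++ [x]).IsChain G.Adj) :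
    ABCGG G < √3 + 2 * √2 + 2 * √(5 / 6) ∨ Nonempty (G ≃g S33 1 0 1 0 0) := by
  have hle := hnd.length_le_card
  rw [hV] at hle
  have hreal := realizes_twoCycles h₁ h₁₂ hle hnd hc₁ hc₂
  generalize hm : l₁.length = m at *
  generalize hk : l₂.length = k at *
  simp only [List.cons_append, List.length_cons, List.length_append] at hle
  obtain ⟨rfl, rfl⟩ | ⟨rfl, rfl⟩ | ⟨rfl, rfl⟩ | ⟨rfl, rfl⟩ :
      m = 2 ∧ k = 2 ∨ m = 2 ∧ k = 3 ∨ m = 2 ∧ k = 4 ∨ m = 3 ∧ k = 3 := by omega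
  · have hL : (x :: l₁ ++ l₂).length = 5 := by simp [hm, hk]
    obtain ⟨i, hi, y, hy⟩ := hreal.exists_extend hG (by omega) (by omega)
    have hL' : (x :: l₁ ++ l₂ ++ [y]).length = 6 := by rw [List.length_append, hL]; rfl
    obtain ⟨j, hj, z, hz⟩ := hy.exists_extend hG (by omega) (by omega)
    rw [hL'] at hj hz
    rw [hL] at hi hz
    obtain ⟨hcard, hb | ⟨hinj, hadj⟩⟩ := two_triangles_cases i hi j hj
    · exact .inl (hz.ABCGG_lt hG hV (by rw [List.length_append, hL']; rfl) hedge hcard hb)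
    · obtain ⟨e⟩ := hz.nonempty_iso hV (by rw [List.length_append, hL']; rfl) (by omega)
      obtain ⟨e'⟩ := nonempty_iso_of_ncard_edgeSet_le _ hinj (by simp) hadj (by
        rw [ncard_edgeSet_S33, ← SimpleGraph.coe_edgeFinset, Set.ncard_coe_finset, hcard])
      exact .inr ⟨e.symm.trans e'⟩
  · have hL : (x :: l₁ ++ l₂).length = 6 := by simp [hm, hk]
    obtain ⟨i, hi, y, hy⟩ := hreal.exists_extend hG (by omega) (by omega)
    rw [hL] at hi hy
    obtain ⟨hcard, hb⟩ := triangle_square_cases i hi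
    exact .inl (hy.ABCGG_lt hG hV (by rw [List.length_append, hL]; rfl) hedge hcard hb)
  · exact .inl (hreal.ABCGG_lt hG hV (by simp [hm, hk]) hedge (by decide +kernel)
      (by decide +kernel))
  · exact .inl (hreal.ABCGG_lt hG hV (by simp [hm, hk]) hedge (by decide +kernel)
      (by decide +kernel))

theorem stmt11 {V : Type*} [Fintype V] (G : SimpleGraph V) (r t : ℕ)
    (hr : 3 ≤ r) (ht : 3 ≤ t) (hG : InSnrt G 7 r t) :
    ABCGG G ≤ Real.sqrt 3 + 2 * Real.sqrt 2 + 2 * Real.sqrt (5 / 6) ∧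
    (ABCGG G = Real.sqrt 3 + 2 * Real.sqrt 2 + 2 * Real.sqrt (5 / 6) ↔
      Nonempty (G ≃g S33 1 0 1 0 0)) := by
  obtain ⟨hV, hconn, hedge, a, b, c₁, c₂, hc₁, hc₂, -, -, hinter⟩ := hG
  obtain ⟨x, hx⟩ := Set.ncard_eq_one.mp hinter
  have hx₁₂ : x ∈ ({v | v ∈ c₁.support} ∩ {v | v ∈ c₂.support} : Set V) := by simp [hx]
  obtain ⟨l₁, hl₁, hnd₁, hch₁, hsub₁⟩ := exists_list_of_isCycle hc₁ hx₁₂.1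
  obtain ⟨l₂, hl₂, hnd₂, hch₂, hsub₂⟩ := exists_list_of_isCycle hc₂ hx₁₂.2
  have hdisj : l₁.Disjoint l₂ := by
    intro y hy₁ hy₂
    have hy : y ∈ ({v | v ∈ c₁.support} ∩ {v | v ∈ c₂.support} : Set V) :=
      ⟨hsub₁ y hy₁, hsub₂ y hy₂⟩
    rw [hx, Set.mem_singleton_iff] at hy
    exact (List.nodup_cons.mp hnd₁).1 (hy ▸ hy₁)
  have hnd₁₂ : (x :: l₁ ++ l₂).Nodup :=
    hnd₁.append (List.nodup_cons.mp hnd₂).2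
      (List.disjoint_cons_left.mpr ⟨(List.nodup_cons.mp hnd₂).1, hdisj⟩)
  have hnd₂₁ : (x :: l₂ ++ l₁).Nodup :=
    hnd₂.append (List.nodup_cons.mp hnd₁).2
      (List.disjoint_cons_left.mpr ⟨(List.nodup_cons.mp hnd₁).1, hdisj.symm⟩)
  have hmain : ABCGG G < √3 + 2 * √2 + 2 * √(5 / 6) ∨ Nonempty (G ≃g S33 1 0 1 0 0) := by
    rcases le_total l₁.length l₂.length with h | h
    · exact ABCGG_lt_or_nonempty_iso hV hconn hedge hl₁ h hnd₁₂ hch₁ hch₂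
    · exact ABCGG_lt_or_nonempty_iso hV hconn hedge hl₂ h hnd₂₁ hch₂ hch₁
  have heq : Nonempty (G ≃g S33 1 0 1 0 0) → ABCGG G = √3 + 2 * √2 + 2 * √(5 / 6) :=
    fun ⟨e⟩ => (ABCGG_iso e).trans (ABCGG_S33 (e.connected_iff.mp hconn))
  exact ⟨hmain.elim le_of_lt fun h => (heq h).le,
    fun h => hmain.resolve_left h.not_lt, heq⟩
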